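/- Let r ∈ ℝ and let φ : ℍ → ℂ be a smooth eigenfunction of the hyperbolic Laplacian: y²·(∂²φ/∂x² + ∂²φ/∂y²) = −(1/4 + r²)·φ. Define smooth functions φ_n(x,y,θ) for n ∈ ℤ on ℝ × (0,∞) × ℝ by φ_0(x,y,θ) = φ(x+iy) and the recursions φ_{n+1} = E⁺φ_n/(2ir+1+2n) and φ_{n−1} = E⁻φ_n/(2ir+1−2n). Then for every integer n and every smooth, compactly supported f : ℍ → ℂ satisfying f(k_α·z) = e^{2inα}·f(z) for all α ∈ ℝ and z ∈ ℍ, one has ∫_ℍ f((p_{x+iy} k_θ)^{−1}·w)·φ(w) dμ(w) = 𝒮_n f(r) · φ_{−n}(x,y,θ) for all (x,y,θ) ∈ ℝ × (0,∞) × ℝ. -/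

import Mathlib

open MeasureTheory Complex

noncomputable section

/-- Möbius action of a real 2×2 matrix on a complex number. -/
def moebius (g : Matrix (Fin 2) (Fin 2) ℝ) (z : ℂ) : ℂ :=
  ((g 0 0 : ℂ) * z + (g 0 1 : ℂ)) / ((g 1 0 : ℂ) * z + (g 1 1 : ℂ))

/-- The rotation matrix `k_θ ∈ SL(2,ℝ)`. -/
def kMat (θ : ℝ) : Matrix (Fin 2) (Fin 2) ℝ :=
  !![Real.cos θ, Real.sin θ; -Real.sin θ, Real.cos θ]

/-- The matrix `p_z = ((√y, x/√y), (0, 1/√y)) ∈ SL(2,ℝ)` for `z = x + iy`. -/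
def pMat (x y : ℝ) : Matrix (Fin 2) (Fin 2) ℝ :=
  !![Real.sqrt y, x / Real.sqrt y; 0, 1 / Real.sqrt y]

/-- The function `φ_r(z) = (Im z)^{ir + 1/2}`. -/
def phir (r : ℝ) (z : ℂ) : ℂ :=
  Complex.exp ((r * Complex.I + 1 / 2) * Complex.log (z.im))

/-- The generalized spherical function
`Φ_{r,n}(z) = (1/π) ∫_0^π φ_r(k_θ⁻¹ · z) e^{2inθ} dθ` (note `k_θ⁻¹ = k_{-θ}`). -/
def sphFn (r : ℝ) (n : ℤ) (z : ℂ) : ℂ :=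
  (1 / Real.pi : ℂ) * ∫ θ in (0 : ℝ)..Real.pi,
    phir r (moebius (kMat (-θ)) z) * Complex.exp (2 * n * θ * Complex.I)

/-- The hyperbolic measure `dμ = dx·dy/y²` on the upper half-plane, viewed as a
measure on ℂ supported on `{z : 0 < Im z}`. -/
def hypMeasure : Measure ℂ :=
  (volume.withDensity fun z => ENNReal.ofReal ((z.im)⁻¹ ^ 2)).restrict {z : ℂ | 0 < z.im}

/-- The `n`-spherical transform `𝒮_n f(r) = ∫_ℍ f(z)·Φ_{r,−n}(z) dμ(z)`. -/
def sphTransform (n : ℤ) (f : ℂ → ℂ) (r : ℝ) : ℂ :=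
  ∫ z, f z * sphFn r (-n) z ∂hypMeasure

/-- The operator `W = ∂/∂θ` in the coordinates `(x,y,θ)` of `PSL(2,ℝ)`. -/
def Wop (F : ℝ → ℝ → ℝ → ℂ) (x y θ : ℝ) : ℂ := deriv (fun t => F x y t) θ

/-- The operator `H = −2y sin(2θ)∂_x + 2y cos(2θ)∂_y + sin(2θ)∂_θ`. -/
def Hop (F : ℝ → ℝ → ℝ → ℂ) (x y θ : ℝ) : ℂ :=
  -(2 * y * Real.sin (2 * θ)) * deriv (fun t => F t y θ) x
    + (2 * y * Real.cos (2 * θ)) * deriv (fun t => F x t θ) y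
    + (Real.sin (2 * θ) : ℂ) * deriv (fun t => F x y t) θ

/-- The operator `X = y cos(2θ)∂_x + y sin(2θ)∂_y + sin²(θ)∂_θ`. -/
def Xop (F : ℝ → ℝ → ℝ → ℂ) (x y θ : ℝ) : ℂ :=
  (y * Real.cos (2 * θ)) * deriv (fun t => F t y θ) x
    + (y * Real.sin (2 * θ)) * deriv (fun t => F x t θ) y
    + ((Real.sin θ) ^ 2 : ℂ) * deriv (fun t => F x y t) θ

/-- The raising operator `E⁺ = H + i(2X − W)`. -/
def Eplus (F : ℝ → ℝ → ℝ → ℂ) (x y θ : ℝ) : ℂ :=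
  Hop F x y θ + Complex.I * (2 * Xop F x y θ - Wop F x y θ)

/-- The lowering operator `E⁻ = H − i(2X − W)`. -/
def Eminus (F : ℝ → ℝ → ℝ → ℂ) (x y θ : ℝ) : ℂ :=
  Hop F x y θ - Complex.I * (2 * Xop F x y θ - Wop F x y θ)

/-- A family of functions on the upper half-plane linked by the raising and lowering relations
with spectral parameter `s`. -/
def IsLadder (s : ℂ) (u : ℤ → ℝ → ℝ → ℂ) : Prop :=
  ∀ m x y, 0 < y → ∃ L : ℝ × ℝ →L[ℝ] ℂ, HasFDerivAt (fun p : ℝ × ℝ => u m p.1 p.2) L (x, y) ∧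
    (s + m) * u (m + 1) x y = I * y * L (1, 0) + y * L (0, 1) + m * u m x y ∧
    (s - m) * u (m - 1) x y = -(I * y * L (1, 0)) + y * L (0, 1) - m * u m x y

/-- The function on `SL(2,ℝ)` attached to `u m`, in terms of the matrix entries. -/
def ladderLift (u : ℤ → ℝ → ℝ → ℂ) (m : ℤ) (a b c d : ℝ) : ℂ :=
  u m ((a * c + b * d) / (c ^ 2 + d ^ 2)) (1 / (c ^ 2 + d ^ 2)) *
    (((d : ℂ) - c * I) / (d + c * I)) ^ m

lemma add_mul_I_ne_zero {c d : ℝ} (h : 0 < c ^ 2 + d ^ 2) : (d : ℂ) + c * I ≠ 0 := by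
  intro h0
  have h1 := congrArg re h0
  have h2 := congrArg im h0
  simp at h1 h2
  simp [h1, h2] at h

lemma sub_mul_I_ne_zero {c d : ℝ} (h : 0 < c ^ 2 + d ^ 2) : (d : ℂ) - c * I ≠ 0 := by
  intro h0
  have h1 := congrArg re h0
  have h2 := congrArg im h0
  simp at h1 h2
  simp [h1, h2] at h

lemma sq_add_sq_pos_of_det {a b c d : ℝ} (h : a * d - b * c = 1) : 0 < c ^ 2 + d ^ 2 := by
  by_contra h'
  have hc : c = 0 := by nlinarith [sq_nonneg c, sq_nonneg d]
  have hd : d = 0 := by nlinarith [sq_nonneg c, sq_nonneg d]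
  simp [hc, hd] at h

lemma IsLadder.hasDerivAt_lift {s : ℂ} {u : ℤ → ℝ → ℝ → ℂ} (hu : IsLadder s u) (m : ℤ)
    {a b c d : ℝ → ℝ} {p q r τ : ℝ} (hdet : a τ * d τ - b τ * c τ = 1)
    (ha : HasDerivAt a (a τ * p + b τ * r) τ) (hb : HasDerivAt b (a τ * q - b τ * p) τ)
    (hc : HasDerivAt c (c τ * p + d τ * r) τ) (hd : HasDerivAt d (c τ * q - d τ * p) τ) :
    HasDerivAt (fun t => ladderLift u m (a t) (b t) (c t) (d t))
      (p * ((s + m) * ladderLift u (m + 1) (a τ) (b τ) (c τ) (d τ)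
          + (s - m) * ladderLift u (m - 1) (a τ) (b τ) (c τ) (d τ))
        - (q + r) / 2 * I * ((s + m) * ladderLift u (m + 1) (a τ) (b τ) (c τ) (d τ)
          - (s - m) * ladderLift u (m - 1) (a τ) (b τ) (c τ) (d τ))
        + (q - r) * I * m * ladderLift u m (a τ) (b τ) (c τ) (d τ)) τ := by
  have hN := sq_add_sq_pos_of_det hdet
  obtain ⟨L, hL, h1, h2⟩ := hu m ((a τ * c τ + b τ * d τ) / (c τ ^ 2 + d τ ^ 2))
    (1 / (c τ ^ 2 + d τ ^ 2)) (by positivity)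
  have hNd : HasDerivAt (fun t => c t ^ 2 + d t ^ 2)
      (2 * (p * (c τ ^ 2 - d τ ^ 2) + (q + r) * (c τ * d τ))) τ := by
    convert! (hc.pow 2).add (hd.pow 2) using 1
    push_cast; ring
  have hx : HasDerivAt (fun t => (a t * c t + b t * d t) / (c t ^ 2 + d t ^ 2))
      ((4 * p * c τ * d τ + (q + r) * (d τ ^ 2 - c τ ^ 2)) / (c τ ^ 2 + d τ ^ 2) ^ 2) τ := by
    convert! ((ha.mul hc).add (hb.mul hd)).div hNd hN.ne' using 1
    congr 1
    simp only [Pi.mul_apply, Pi.add_apply]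
    generalize a τ = a at *
    generalize b τ = b at *
    generalize c τ = c at *
    generalize d τ = d at *
    linear_combination -(4 * p * c * d + (q + r) * (d ^ 2 - c ^ 2)) * hdet
  have hy : HasDerivAt (fun t => 1 / (c t ^ 2 + d t ^ 2))
      (-(2 * (p * (c τ ^ 2 - d τ ^ 2) + (q + r) * (c τ * d τ))) / (c τ ^ 2 + d τ ^ 2) ^ 2) τ := by
    simpa only [one_div] using hNd.fun_inv hN.ne'
  have hp := add_mul_I_ne_zero hN
  have hm := sub_mul_I_ne_zero hN
  have hε : HasDerivAt (fun t => ((d t : ℂ) - c t * I) / (d t + c t * I))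
      ((((d τ : ℂ) - c τ * I) / (d τ + c τ * I)) *
        (2 * I * (c τ ^ 2 * q - 2 * c τ * d τ * p - d τ ^ 2 * r) / (c τ ^ 2 + d τ ^ 2))) τ := by
    have := (hd.ofReal_comp.sub (hc.ofReal_comp.mul_const I)).div
      (hd.ofReal_comp.add (hc.ofReal_comp.mul_const I)) hp
    convert! this using 1
    have hNC : ((c τ : ℂ) ^ 2 + d τ ^ 2) = (d τ + c τ * I) * (d τ - c τ * I) := by
      linear_combination ((c τ : ℂ) ^ 2) * I_sq
    simp only [Pi.add_apply, Pi.sub_apply]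
    rw [hNC]
    field_simp
    push_cast
    ring
  have hε0 : ((d τ : ℂ) - c τ * I) / (d τ + c τ * I) ≠ 0 := div_ne_zero hm hp
  have hεm := (hasDerivAt_zpow m _ (Or.inl hε0)).comp τ hε
  have hu' := hL.comp_hasDerivAt τ (hx.prodMk hy)
  have key := hu'.mul hεm
  refine key.congr_deriv ?_
  have hLxy : ∀ v w : ℝ, L (v, w) = v * L (1, 0) + w * L (0, 1) := by
    intro v w
    have : (v, w) = v • ((1 : ℝ), (0 : ℝ)) + w • ((0 : ℝ), (1 : ℝ)) := by simp
    rw [this, map_add, map_smul, map_smul]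
    simp
  rw [hLxy]
  simp only [ladderLift, Function.comp_apply, zpow_add₀ hε0, zpow_sub₀ hε0, zpow_one]
  set x := (a τ * c τ + b τ * d τ) / (c τ ^ 2 + d τ ^ 2)
  set X := L (1, 0)
  set Y := L (0, 1)
  have e1 : ((d τ : ℂ) - c τ * I) / (d τ + c τ * I) =
      ((d τ : ℂ) ^ 2 - c τ ^ 2 - 2 * c τ * d τ * I) / (c τ ^ 2 + d τ ^ 2) := by
    have hNC : ((c τ : ℂ) ^ 2 + d τ ^ 2) = (d τ + c τ * I) * (d τ - c τ * I) := by
      linear_combination ((c τ : ℂ) ^ 2) * I_sq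
    rw [hNC]
    field_simp
    linear_combination (c τ : ℂ) ^ 2 * I_sq
  have e2 : (((d τ : ℂ) - c τ * I) / (d τ + c τ * I))⁻¹ =
      ((d τ : ℂ) ^ 2 - c τ ^ 2 + 2 * c τ * d τ * I) / (c τ ^ 2 + d τ ^ 2) := by
    have hNC : ((c τ : ℂ) ^ 2 + d τ ^ 2) = (d τ + c τ * I) * (d τ - c τ * I) := by
      linear_combination ((c τ : ℂ) ^ 2) * I_sq
    rw [hNC]
    field_simp
    linear_combination (c τ : ℂ) ^ 2 * I_sq
  have hNc : ((c τ : ℂ) ^ 2 + d τ ^ 2) ≠ 0 := by exact_mod_cast hN.ne'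
  rw [div_eq_mul_inv _ (((d τ : ℂ) - c τ * I) / (d τ + c τ * I))]
  set ε := ((d τ : ℂ) - c τ * I) / (d τ + c τ * I)
  have g1 : ∀ E : ℂ, (s + m) * (u (m + 1) x (1 / (c τ ^ 2 + d τ ^ 2) : ℝ) * E) =
    (I * ((1 / (c τ ^ 2 + d τ ^ 2) : ℝ) : ℂ) * X + ((1 / (c τ ^ 2 + d τ ^ 2) : ℝ) : ℂ) * Y +
      m * u m x (1 / (c τ ^ 2 + d τ ^ 2))) * E := by intro E; rw [← mul_assoc, h1]
  have g2 : ∀ E : ℂ, (s - m) * (u (m - 1) x (1 / (c τ ^ 2 + d τ ^ 2)) * E) =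
    (-(I * ((1 / (c τ ^ 2 + d τ ^ 2) : ℝ) : ℂ) * X) + ((1 / (c τ ^ 2 + d τ ^ 2) : ℝ) : ℂ) * Y -
      m * u m x (1 / (c τ ^ 2 + d τ ^ 2))) * E := by intro E; rw [← mul_assoc, h2]
  rw [g1, g2]
  set E := ε ^ m
  set U := u m x (1 / (c τ ^ 2 + d τ ^ 2))
  have hz : ε⁻¹ * ε = 1 := inv_mul_cancel₀ hε0
  rw [show (m : ℂ) * (E * ε⁻¹) * (ε * (2 * I * (↑(c τ) ^ 2 * ↑q - 2 * ↑(c τ) * ↑(d τ) * ↑p -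
      ↑(d τ) ^ 2 * ↑r) / (↑(c τ) ^ 2 + ↑(d τ) ^ 2))) =
      (m : ℂ) * E * (2 * I * (↑(c τ) ^ 2 * ↑q - 2 * ↑(c τ) * ↑(d τ) * ↑p -
      ↑(d τ) ^ 2 * ↑r) / (↑(c τ) ^ 2 + ↑(d τ) ^ 2)) by
    linear_combination (m : ℂ) * E * (2 * I * (↑(c τ) ^ 2 * ↑q - 2 * ↑(c τ) * ↑(d τ) * ↑p -
      ↑(d τ) ^ 2 * ↑r) / (↑(c τ) ^ 2 + ↑(d τ) ^ 2)) * hz]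
  rw [e2, e1]
  push_cast
  generalize (c τ : ℂ) = c at *
  generalize (d τ : ℂ) = d at *
  field_simp
  ring_nf
  simp only [I_sq]
  ring

lemma eq_zero_of_regular_singular_system {p q : ℝ → ℂ} {A B : ℂ} {C D : ℝ}
    (hpc : Continuous p) (hqc : Continuous q)
    (hp : ∀ t : ℝ, 0 < t → HasDerivAt p (A * q t - C * Real.tanh t * p t) t)
    (hq : ∀ t : ℝ, 0 < t →
      HasDerivAt q (B * p t - (2 / Real.sinh (2 * t) + D * Real.tanh t : ℝ) * q t) t)
    (hp0 : p 0 = 0) (hq0 : q 0 = 0) : ∀ t : ℝ, 0 ≤ t → p t = 0 ∧ q t = 0 := by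
  set K : ℝ := ‖A‖ + ‖B‖ + 2 * |C| + 2 * |D| with hK
  set E : ℝ → ℝ := fun t => (‖p t‖ ^ 2 + ‖q t‖ ^ 2) * Real.exp (-K * t) with hE
  have hanti : AntitoneOn E (Set.Ici 0) := by
    have hder : ∀ t ∈ interior (Set.Ici (0 : ℝ)), ∃ E' : ℝ, HasDerivAt E E' t ∧ E' ≤ 0 := by
      intro t ht
      rw [interior_Ici, Set.mem_Ioi] at ht
      have h1 := (hp t ht).norm_sq
      have h2 := (hq t ht).norm_sq
      have h3 : HasDerivAt (fun t : ℝ => Real.exp (-K * t)) (Real.exp (-K * t) * (-K)) t := by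
        simpa using ((hasDerivAt_id t).const_mul (-K)).exp
      refine ⟨_, (h1.add h2).mul h3, ?_⟩
      have hs : 0 < Real.sinh (2 * t) := Real.sinh_pos_iff.2 (by linarith)
      have ht0 : 0 ≤ Real.tanh t := by
        rw [Real.tanh_eq_sinh_div_cosh]
        exact div_nonneg (Real.sinh_nonneg_iff.2 ht.le) (Real.cosh_pos t).le
      have ht1 : Real.tanh t ≤ 1 := (Real.tanh_lt_one t).le
      have hself : ∀ z : ℂ, inner ℝ z z = ‖z‖ ^ 2 := real_inner_self_eq_norm_sq
      have e1 : inner ℝ (p t) (A * q t - C * Real.tanh t * p t) ≤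
          ‖p t‖ * (‖A‖ * ‖q t‖) + |C| * ‖p t‖ ^ 2 := by
        rw [inner_sub_right]
        have : (C : ℂ) * Real.tanh t * p t = (C * Real.tanh t) • p t := by simp
        rw [this, inner_smul_right, hself]
        have i1 := real_inner_le_norm (p t) (A * q t)
        rw [norm_mul] at i1
        have i2 : -(C * Real.tanh t) ≤ |C| := by
          nlinarith [neg_abs_le C, abs_nonneg C]
        nlinarith [sq_nonneg ‖p t‖]
      have e2 : inner ℝ (q t) (B * p t - (2 / Real.sinh (2 * t) + D * Real.tanh t : ℝ) * q t) ≤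
          ‖q t‖ * (‖B‖ * ‖p t‖) + |D| * ‖q t‖ ^ 2 := by
        rw [inner_sub_right]
        rw [← Complex.real_smul, inner_smul_right, hself]
        have i1 := real_inner_le_norm (q t) (B * p t)
        rw [norm_mul] at i1
        have i2 : -(D * Real.tanh t) ≤ |D| := by
          nlinarith [neg_abs_le D, abs_nonneg D]
        have i3 : 0 < 2 / Real.sinh (2 * t) := by positivity
        nlinarith [sq_nonneg ‖q t‖]
      have e3 : 2 * inner ℝ (p t) (A * q t - C * Real.tanh t * p t) +
          2 * inner ℝ (q t) (B * p t - (2 / Real.sinh (2 * t) + D * Real.tanh t : ℝ) * q t) ≤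
          K * (‖p t‖ ^ 2 + ‖q t‖ ^ 2) := by
        have := mul_nonneg (add_nonneg (norm_nonneg A) (norm_nonneg B)) (sq_nonneg (‖p t‖ - ‖q t‖))
        have j1 := mul_nonneg (abs_nonneg C) (sq_nonneg ‖q t‖)
        have j2 := mul_nonneg (abs_nonneg D) (sq_nonneg ‖p t‖)
        rw [hK]
        nlinarith
      have := Real.exp_pos (-K * t)
      simp only [Pi.add_apply]
      nlinarith
    refine antitoneOn_of_deriv_nonpos (convex_Ici 0) ?_ ?_ ?_
    · exact Continuous.continuousOn (by fun_prop)
    · intro t ht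
      obtain ⟨E', h, -⟩ := hder t ht
      exact h.differentiableAt.differentiableWithinAt
    · intro t ht
      obtain ⟨E', h, h'⟩ := hder t ht
      rwa [h.deriv]
  intro t ht
  have h := hanti (Set.self_mem_Ici) (Set.mem_Ici.2 ht) ht
  simp only [hE, hp0, hq0, norm_zero] at h
  have h0 := Real.exp_pos (-K * t)
  have h1 : ‖p t‖ ^ 2 + ‖q t‖ ^ 2 ≤ 0 := by
    by_contra! h'
    have := mul_pos h' h0
    norm_num at h
    rw [neg_mul] at this
    linarith
  constructor
  · rw [← norm_eq_zero]; nlinarith [sq_nonneg ‖p t‖, sq_nonneg ‖q t‖]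
  · rw [← norm_eq_zero]; nlinarith [sq_nonneg ‖p t‖, sq_nonneg ‖q t‖]

lemma radial_system_eq_zero {s : ℂ} (hs : ∀ m : ℤ, s + m ≠ 0) {n : ℤ} {v : ℤ → ℝ → ℂ}
    (hder : ∀ m t, HasDerivAt (v m) ((s + m) * v (m + 1) t + (s - m) * v (m - 1) t) t)
    (hrel : ∀ m t, -(n : ℂ) * 2 * v m t = Real.sinh (2 * t) *
      ((s + m) * v (m + 1) t - (s - m) * v (m - 1) t) + 2 * m * Real.cosh (2 * t) * v m t)
    (h0 : v (-n) 0 = 0) (h1 : v (-n + 1) 0 = 0) (m : ℤ) {t : ℝ} (ht : 0 ≤ t) : v m t = 0 := by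
  have hcont : ∀ m, Continuous (v m) := fun m =>
    continuous_iff_continuousAt.2 fun t => (hder m t).continuousAt
  have hcosh : ∀ t : ℝ, Real.cosh t ≠ 0 := fun t => (Real.cosh_pos t).ne'
  have hmain := eq_zero_of_regular_singular_system (p := v (-n)) (q := v (-n + 1))
    (A := 2 * (s - n)) (B := 2 * (s + n - 1)) (C := 2 * n) (D := 2 * (1 - n)) (hcont _) (hcont _) ?_ ?_ h0 h1
  · have hpos : ∀ k : ℤ, (∀ t : ℝ, 0 < t → v k t = 0) → ∀ t : ℝ, 0 < t →
        (s + k) * v (k + 1) t + (s - k) * v (k - 1) t = 0 := by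
      intro k hk t ht
      refine (hder k t).unique ?_
      refine (hasDerivAt_const t (0 : ℂ)).congr_of_eventuallyEq ?_
      filter_upwards [lt_mem_nhds ht] with t' ht' using hk t' ht'
    have hs' : ∀ m : ℤ, s - m ≠ 0 := fun m => by simpa [sub_eq_add_neg] using hs (-m)
    have hup : ∀ k : ℕ, (∀ t : ℝ, 0 < t → v (-n + k) t = 0) ∧
        ∀ t : ℝ, 0 < t → v (-n + k + 1) t = 0 := by
      intro k
      induction k with
      | zero => simpa using ⟨fun t ht => (hmain t ht.le).1, fun t ht => (hmain t ht.le).2⟩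
      | succ k ih =>
        push_cast
        refine ⟨by simpa [add_assoc] using ih.2, fun t ht => ?_⟩
        have := hpos _ ih.2 t ht
        rw [show -n + (k : ℤ) + 1 - 1 = -n + k by ring, ih.1 t ht, mul_zero, add_zero] at this
        rw [← add_assoc]
        exact (mul_eq_zero.1 this).resolve_left (hs _)
    have hdown : ∀ k : ℕ, (∀ t : ℝ, 0 < t → v (-n - k) t = 0) ∧
        ∀ t : ℝ, 0 < t → v (-n - k + 1) t = 0 := by
      intro k
      induction k with
      | zero => simpa using ⟨fun t ht => (hmain t ht.le).1, fun t ht => (hmain t ht.le).2⟩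
      | succ k ih =>
        push_cast
        refine ⟨fun t ht => ?_, by simpa [← sub_sub] using ih.1⟩
        have := hpos _ ih.1 t ht
        rw [ih.2 t ht, mul_zero, zero_add] at this
        rw [← sub_sub]
        exact (mul_eq_zero.1 this).resolve_left (hs' _)
    have hall : ∀ t : ℝ, 0 < t → v m t = 0 := by
      rcases le_total (-n) m with h | h
      · have := (hup (m + n).toNat).1
        rwa [Int.toNat_of_nonneg (by omega), show -n + (m + n) = m by ring] at this
      · have := (hdown (-n - m).toNat).1
        rwa [Int.toNat_of_nonneg (by omega), show -n - (-n - m) = m by ring] at this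
    have hcl : Set.EqOn (v m) (fun _ => 0) (closure (Set.Ioi 0)) :=
      Set.EqOn.closure (fun t ht => hall t ht) (hcont m) continuous_const
    rw [closure_Ioi] at hcl
    exact hcl ht
  · intro t ht
    refine (hder (-n) t).congr_deriv ?_
    have hr := hrel (-n) t
    have hsh : (Real.sinh t : ℂ) ≠ 0 := by exact_mod_cast Real.sinh_ne_zero.2 ht.ne'
    have hch : (Real.cosh t : ℂ) ≠ 0 := by exact_mod_cast hcosh t
    rw [Real.sinh_two_mul, Real.cosh_two_mul, Real.cosh_sq] at hr
    rw [Real.tanh_eq_sinh_div_cosh]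
    push_cast at hr hsh hch ⊢
    have : cosh (t : ℂ) * ((s - n) * v (-n + 1) t - (s + n) * v (-n - 1) t) =
      2 * n * sinh (t : ℂ) * v (-n) t := by
      apply mul_left_cancel₀ hsh
      linear_combination -hr / 2
    field_simp
    linear_combination -this
  · intro t ht
    refine (hder (-n + 1) t).congr_deriv ?_
    have hr := hrel (-n + 1) t
    have hsh : (Real.sinh t : ℂ) ≠ 0 := by exact_mod_cast Real.sinh_ne_zero.2 ht.ne'
    have hch : (Real.cosh t : ℂ) ≠ 0 := by exact_mod_cast hcosh t
    have hid : (cosh (t : ℂ)) ^ 2 = sinh (t : ℂ) ^ 2 + 1 := Complex.cosh_sq _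
    rw [Real.sinh_two_mul, Real.cosh_two_mul] at hr
    rw [Real.tanh_eq_sinh_div_cosh, Real.sinh_two_mul]
    rw [show -n + 1 - 1 = -n by ring] at hr ⊢
    push_cast at hr hsh hch ⊢
    field_simp
    linear_combination -hr / 2 - (1 - n) * v (-n + 1) t * hid
/-- The lift of `u m` to the matrix `g k_α a_t`, where `g` has entries `a b c d` and
`a_t = diag (e^t, e^{-t})`. -/
def polarLift (u : ℤ → ℝ → ℝ → ℂ) (a b c d : ℝ) (m : ℤ) (α t : ℝ) : ℂ :=
  ladderLift u m
    ((a * Real.cos α - b * Real.sin α) * Real.exp t)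
    ((a * Real.sin α + b * Real.cos α) * Real.exp (-t))
    ((c * Real.cos α - d * Real.sin α) * Real.exp t)
    ((c * Real.sin α + d * Real.cos α) * Real.exp (-t))

lemma polar_det {a b c d : ℝ} (h : a * d - b * c = 1) (α t : ℝ) :
    ((a * Real.cos α - b * Real.sin α) * Real.exp t) *
      ((c * Real.sin α + d * Real.cos α) * Real.exp (-t)) -
    ((a * Real.sin α + b * Real.cos α) * Real.exp (-t)) *
      ((c * Real.cos α - d * Real.sin α) * Real.exp t) = 1 := by
  have h1 : Real.exp t * Real.exp (-t) = 1 := by rw [← Real.exp_add]; simp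
  have h2 := Real.sin_sq_add_cos_sq α
  linear_combination (a * d - b * c) * (Real.sin α ^ 2 + Real.cos α ^ 2) * h1 +
    (a * d - b * c) * h2 + h

lemma IsLadder.continuous_polarLift {s : ℂ} {u : ℤ → ℝ → ℝ → ℂ} (hu : IsLadder s u)
    {a b c d : ℝ} (h : a * d - b * c = 1) (m : ℤ) :
    Continuous fun p : ℝ × ℝ => polarLift u a b c d m p.1 p.2 := by
  rw [continuous_iff_continuousAt]
  rintro ⟨α, t⟩
  have hN := sq_add_sq_pos_of_det (polar_det h α t)
  unfold polarLift ladderLift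
  refine ContinuousAt.mul ?_ (ContinuousAt.zpow₀ (ContinuousAt.div (by fun_prop) (by fun_prop)
    (by exact add_mul_I_ne_zero hN)) _ (Or.inl (div_ne_zero (by exact sub_mul_I_ne_zero hN)
    (by exact add_mul_I_ne_zero hN))))
  obtain ⟨L, hL, -⟩ := hu m _ _ (one_div_pos.2 hN)
  have hN' : ContinuousAt (fun p : ℝ × ℝ => ((c * Real.cos p.1 - d * Real.sin p.1) *
      Real.exp p.2) ^ 2 + ((c * Real.sin p.1 + d * Real.cos p.1) * Real.exp (-p.2)) ^ 2) (α, t) := by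
    fun_prop
  have hx : ContinuousAt (fun p : ℝ × ℝ => ((a * Real.cos p.1 - b * Real.sin p.1) * Real.exp p.2) *
      ((c * Real.cos p.1 - d * Real.sin p.1) * Real.exp p.2) +
      ((a * Real.sin p.1 + b * Real.cos p.1) * Real.exp (-p.2)) *
      ((c * Real.sin p.1 + d * Real.cos p.1) * Real.exp (-p.2))) (α, t) := by
    fun_prop
  exact ContinuousAt.comp (x := (α, t)) hL.continuousAt
    ((hx.div hN' hN.ne').prodMk (continuousAt_const.div hN' hN.ne'))

lemma IsLadder.continuous_polarLift_left {s : ℂ} {u : ℤ → ℝ → ℝ → ℂ} (hu : IsLadder s u)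
    {a b c d : ℝ} (h : a * d - b * c = 1) (m : ℤ) (t : ℝ) :
    Continuous fun α => polarLift u a b c d m α t :=
  Continuous.comp (g := fun p : ℝ × ℝ => polarLift u a b c d m p.1 p.2)
    (f := fun α : ℝ => (α, t)) (hu.continuous_polarLift h m) (by fun_prop)

lemma IsLadder.hasDerivAt_polarLift_radial {s : ℂ} {u : ℤ → ℝ → ℝ → ℂ} (hu : IsLadder s u)
    {a b c d : ℝ} (h : a * d - b * c = 1) (m : ℤ) (α t : ℝ) :
    HasDerivAt (fun t => polarLift u a b c d m α t)
      ((s + m) * polarLift u a b c d (m + 1) α t +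
        (s - m) * polarLift u a b c d (m - 1) α t) t := by
  have he : HasDerivAt (fun t => Real.exp t) (Real.exp t) t := Real.hasDerivAt_exp t
  have he' : HasDerivAt (fun t => Real.exp (-t)) (-Real.exp (-t)) t := by
    simpa using (hasDerivAt_neg t).exp
  refine (hu.hasDerivAt_lift (p := 1) (q := 0) (r := 0) m (polar_det h α t)
    ((he.const_mul _).congr_deriv ?_) ((he'.const_mul _).congr_deriv ?_)
    ((he.const_mul _).congr_deriv ?_) ((he'.const_mul _).congr_deriv ?_)).congr_deriv ?_
  · ring
  · ring
  · ring
  · ring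
  · simp [polarLift]

lemma IsLadder.hasDerivAt_polarLift_angular {s : ℂ} {u : ℤ → ℝ → ℝ → ℂ} (hu : IsLadder s u)
    {a b c d : ℝ} (h : a * d - b * c = 1) (m : ℤ) (α t : ℝ) :
    HasDerivAt (fun α => polarLift u a b c d m α t)
      (I * (Real.sinh (2 * t) * ((s + m) * polarLift u a b c d (m + 1) α t -
        (s - m) * polarLift u a b c d (m - 1) α t) +
        2 * m * Real.cosh (2 * t) * polarLift u a b c d m α t)) α := by
  have hc : ∀ A B : ℝ, HasDerivAt (fun α => A * Real.cos α - B * Real.sin α)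
      (-(A * Real.sin α + B * Real.cos α)) α := fun A B =>
    (((Real.hasDerivAt_cos α).const_mul A).sub ((Real.hasDerivAt_sin α).const_mul B)).congr_deriv
      (by ring)
  have hs : ∀ A B : ℝ, HasDerivAt (fun α => A * Real.sin α + B * Real.cos α)
      (A * Real.cos α - B * Real.sin α) α := fun A B =>
    (((Real.hasDerivAt_sin α).const_mul A).add ((Real.hasDerivAt_cos α).const_mul B)).congr_deriv
      (by ring)
  have h1 : Real.exp t * Real.exp (-t) = 1 := by rw [← Real.exp_add]; simp
  refine (hu.hasDerivAt_lift (p := 0) (q := Real.exp (-t) ^ 2) (r := -Real.exp t ^ 2) m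
    (polar_det h α t)
    (((hc a b).mul_const _).congr_deriv ?_) (((hs a b).mul_const _).congr_deriv ?_)
    (((hc c d).mul_const _).congr_deriv ?_) (((hs c d).mul_const _).congr_deriv ?_)).congr_deriv ?_
  · linear_combination (a * Real.sin α + b * Real.cos α) * Real.exp t * h1
  · linear_combination -(a * Real.cos α - b * Real.sin α) * Real.exp (-t) * h1
  · linear_combination (c * Real.sin α + d * Real.cos α) * Real.exp t * h1
  · linear_combination -(c * Real.cos α - d * Real.sin α) * Real.exp (-t) * h1
  · have e1 : Real.sinh (2 * t) = (Real.exp t ^ 2 - Real.exp (-t) ^ 2) / 2 := by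
      rw [Real.sinh_eq, ← Real.exp_nat_mul, ← Real.exp_nat_mul]; push_cast; ring_nf
    have e2 : Real.cosh (2 * t) = (Real.exp t ^ 2 + Real.exp (-t) ^ 2) / 2 := by
      rw [Real.cosh_eq, ← Real.exp_nat_mul, ← Real.exp_nat_mul]; push_cast; ring_nf
    rw [e1, e2]
    simp only [polarLift]
    push_cast
    ring

lemma polarLift_add_pi (u : ℤ → ℝ → ℝ → ℂ) (a b c d : ℝ) (m : ℤ) (α t : ℝ) :
    polarLift u a b c d m (α + Real.pi) t = polarLift u a b c d m α t := by
  simp only [polarLift, ladderLift, Real.cos_add_pi, Real.sin_add_pi]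
  congr 2
  · ring_nf
  · ring_nf
  · rw [← neg_div_neg_eq]
    push_cast
    ring_nf

lemma polarLift_zero_right (u : ℤ → ℝ → ℝ → ℂ) {a b c d : ℝ} (h : a * d - b * c = 1) (m : ℤ)
    (α : ℝ) :
    polarLift u a b c d m α 0 = exp (2 * m * α * I) * ladderLift u m a b c d := by
  have hN := sq_add_sq_pos_of_det h
  have hp := add_mul_I_ne_zero hN
  have hm := sub_mul_I_ne_zero hN
  have h2 := Real.sin_sq_add_cos_sq α
  simp only [polarLift, ladderLift, neg_zero, Real.exp_zero, mul_one]
  have e1 : (c * Real.cos α - d * Real.sin α) ^ 2 + (c * Real.sin α + d * Real.cos α) ^ 2 =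
      c ^ 2 + d ^ 2 := by linear_combination (c ^ 2 + d ^ 2) * h2
  have e2 : (a * Real.cos α - b * Real.sin α) * (c * Real.cos α - d * Real.sin α) +
      (a * Real.sin α + b * Real.cos α) * (c * Real.sin α + d * Real.cos α) =
      a * c + b * d := by linear_combination (a * c + b * d) * h2
  have e3 : exp (2 * m * α * I) = (exp (α * I) / exp (-(α * I))) ^ m := by
    rw [← exp_sub, ← exp_int_mul]; congr 1; ring
  rw [e1, e2, e3, mul_left_comm, ← mul_zpow]
  have e4 : exp (α * I) = Real.cos α + Real.sin α * I := by
    rw [exp_mul_I]; push_cast; rfl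
  have e5 : exp (-(α * I)) = Real.cos α - Real.sin α * I := by
    rw [← neg_mul, exp_mul_I]; simp; ring
  congr 2
  rw [div_mul_div_comm, e4, e5]
  congr 1
  · push_cast; linear_combination (c : ℂ) * sin (α : ℂ) * I_sq
  · push_cast; linear_combination (c : ℂ) * sin (α : ℂ) * I_sq

/-- The `n`-th angular Fourier integral of `polarLift`. -/
def radialPart (u : ℤ → ℝ → ℝ → ℂ) (a b c d : ℝ) (n m : ℤ) (t : ℝ) : ℂ :=
  ∫ α in (0 : ℝ)..Real.pi, polarLift u a b c d m α t * exp (2 * n * α * I)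

lemma intervalIntegral_hasDerivAt_of_continuous {F F' : ℝ → ℝ → ℂ}
    (hF : Continuous fun p : ℝ × ℝ => F p.1 p.2) (hF' : Continuous fun p : ℝ × ℝ => F' p.1 p.2)
    (h : ∀ α t, HasDerivAt (fun t => F α t) (F' α t) t) (a b t : ℝ) :
    HasDerivAt (fun t => ∫ α in a..b, F α t) (∫ α in a..b, F' α t) t := by
  obtain ⟨C, hC⟩ := (isCompact_uIcc.prod (isCompact_closedBall t 1)).exists_bound_of_continuousOn
    (f := fun p : ℝ × ℝ => F' p.1 p.2) (s := Set.uIcc a b ×ˢ Metric.closedBall t 1)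
    hF'.continuousOn
  refine (intervalIntegral.hasDerivAt_integral_of_dominated_loc_of_deriv_le
    (F := fun t α => F α t) (F' := fun t α => F' α t) (bound := fun _ => C)
    (Metric.ball_mem_nhds t one_pos) ?_ ?_ ?_ ?_ ?_ ?_).2
  · exact .of_forall fun t => Continuous.aestronglyMeasurable (by fun_prop)
  · exact Continuous.intervalIntegrable (by fun_prop) _ _
  · exact Continuous.aestronglyMeasurable (by fun_prop)
  · exact .of_forall fun α hα t' ht' =>
      hC (α, t') ⟨Set.uIoc_subset_uIcc hα, Metric.ball_subset_closedBall ht'⟩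
  · exact intervalIntegrable_const
  · exact .of_forall fun α _ t' _ => h α t'

lemma IsLadder.hasDerivAt_radialPart {s : ℂ} {u : ℤ → ℝ → ℝ → ℂ} (hu : IsLadder s u)
    {a b c d : ℝ} (h : a * d - b * c = 1) (n m : ℤ) (t : ℝ) :
    HasDerivAt (radialPart u a b c d n m)
      ((s + m) * radialPart u a b c d n (m + 1) t +
        (s - m) * radialPart u a b c d n (m - 1) t) t := by
  have hc := hu.continuous_polarLift h
  have hc' := hu.continuous_polarLift_left h
  refine (intervalIntegral_hasDerivAt_of_continuous
    (F := fun α t => polarLift u a b c d m α t * exp (2 * n * α * I))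
    (F' := fun α t => ((s + m) * polarLift u a b c d (m + 1) α t +
        (s - m) * polarLift u a b c d (m - 1) α t) * exp (2 * n * α * I))
    ?_ ?_ (fun α t => (hu.hasDerivAt_polarLift_radial h m α t).mul_const _) _ _ t).congr_deriv ?_
  · exact (hc m).mul (by fun_prop)
  · exact (((hc _).const_mul _).add ((hc _).const_mul _)).mul (by fun_prop)
  · simp only [radialPart]
    rw [← intervalIntegral.integral_const_mul, ← intervalIntegral.integral_const_mul,
      ← intervalIntegral.integral_add]
    · congr 1; ext α; ring
    · exact Continuous.intervalIntegrable (((hc' _ t).mul (by fun_prop)).const_mul _) _ _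
    · exact Continuous.intervalIntegrable (((hc' _ t).mul (by fun_prop)).const_mul _) _ _

lemma IsLadder.radialPart_relation {s : ℂ} {u : ℤ → ℝ → ℝ → ℂ} (hu : IsLadder s u)
    {a b c d : ℝ} (h : a * d - b * c = 1) (n m : ℤ) (t : ℝ) :
    -(n : ℂ) * 2 * radialPart u a b c d n m t = Real.sinh (2 * t) *
      ((s + m) * radialPart u a b c d n (m + 1) t - (s - m) * radialPart u a b c d n (m - 1) t) +
        2 * m * Real.cosh (2 * t) * radialPart u a b c d n m t := by
  have hc' : ∀ m, Continuous fun α => polarLift u a b c d m α t := fun m =>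
    hu.continuous_polarLift_left h m t
  have hexp : ∀ α : ℝ, HasDerivAt (fun α : ℝ => exp (2 * n * α * I))
      (2 * n * I * exp (2 * n * α * I)) α := fun α =>
    (((((hasDerivAt_id α).ofReal_comp).const_mul (2 * (n : ℂ))).mul_const I).cexp).congr_deriv
      (by simp; ring)
  have hperiod : exp (2 * n * (Real.pi : ℝ) * I) = 1 := by
    rw [show (2 * n * (Real.pi : ℝ) * I : ℂ) = n * (2 * Real.pi * I) by ring]
    exact exp_int_mul_two_pi_mul_I n
  set G : ℤ → ℝ → ℂ := fun m α => polarLift u a b c d m α t * exp (2 * n * α * I) with hG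
  have hGc : ∀ m, Continuous (G m) := fun m => (hc' m).mul (by fun_prop)
  have key := intervalIntegral.integral_eq_sub_of_hasDerivAt (a := 0) (b := Real.pi)
    (fun α _ => ((hu.hasDerivAt_polarLift_angular h m α t).mul (hexp α)).congr_deriv
      (show _ = I * (Real.sinh (2 * t) * ((s + m) * G (m + 1) α - (s - m) * G (m - 1) α) +
        2 * m * Real.cosh (2 * t) * G m α + 2 * n * G m α) by simp only [hG]; ring))
    (Continuous.intervalIntegrable (by fun_prop) _ _)
  have hbd : polarLift u a b c d m Real.pi t = polarLift u a b c d m 0 t := by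
    simpa using polarLift_add_pi u a b c d m 0 t
  simp only [Pi.mul_apply, hperiod, hbd] at key
  have hi : ∀ m, IntervalIntegrable (G m) volume 0 Real.pi := fun m =>
    (hGc m).intervalIntegrable _ _
  rw [intervalIntegral.integral_const_mul, intervalIntegral.integral_add,
    intervalIntegral.integral_add, intervalIntegral.integral_const_mul,
    intervalIntegral.integral_sub, intervalIntegral.integral_const_mul,
    intervalIntegral.integral_const_mul, intervalIntegral.integral_const_mul,
    intervalIntegral.integral_const_mul] at key
  · have hR : ∀ m, radialPart u a b c d n m t = ∫ α in (0 : ℝ)..Real.pi, G m α := fun m => rfl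
    rw [hR, hR, hR]
    simp only [ofReal_zero, mul_zero, zero_mul, exp_zero, sub_self] at key
    linear_combination -(mul_eq_zero.1 key).resolve_left I_ne_zero
  all_goals exact Continuous.intervalIntegrable (by fun_prop) _ _

lemma integral_exp_two_int_mul_I {k : ℤ} (hk : k ≠ 0) :
    ∫ α in (0 : ℝ)..Real.pi, exp (2 * k * α * I) = 0 := by
  have hk' : (2 * k * I : ℂ) ≠ 0 := by simp [hk]
  have := integral_exp_mul_complex (a := 0) (b := Real.pi) hk'
  simp only [mul_right_comm _ I _] at this
  rw [this, show (2 * k * (Real.pi : ℝ) * I : ℂ) = k * (2 * Real.pi * I) by ring,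
    exp_int_mul_two_pi_mul_I]
  simp

lemma radialPart_zero (u : ℤ → ℝ → ℝ → ℂ) {a b c d : ℝ} (h : a * d - b * c = 1) (n m : ℤ) :
    radialPart u a b c d n m 0 = if m = -n then Real.pi * ladderLift u m a b c d else 0 := by
  have : ∀ α : ℝ, polarLift u a b c d m α 0 * exp (2 * n * α * I) =
      ladderLift u m a b c d * exp (2 * (m + n : ℤ) * α * I) := by
    intro α
    rw [polarLift_zero_right u h, mul_right_comm, ← exp_add, mul_comm]
    congr 2; push_cast; ring
  simp only [radialPart, this]
  rw [intervalIntegral.integral_const_mul]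
  split_ifs with hm
  · simp [hm, mul_comm]
  · rw [integral_exp_two_int_mul_I (by omega), mul_zero]

/-- Up to a factor read off at the origin, the radial parts of a ladder family do not depend on
the family or on the base point. -/
lemma IsLadder.radialPart_eq {s : ℂ} (hs : ∀ m : ℤ, s + m ≠ 0) {u u' : ℤ → ℝ → ℝ → ℂ}
    (hu : IsLadder s u) (hu' : IsLadder s u') {a b c d a' b' c' d' : ℝ}
    (h : a * d - b * c = 1) (h' : a' * d' - b' * c' = 1) (n m : ℤ) {t : ℝ} (ht : 0 ≤ t) :
    ladderLift u' (-n) a' b' c' d' * radialPart u a b c d n m t =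
      ladderLift u (-n) a b c d * radialPart u' a' b' c' d' n m t := by
  rw [← sub_eq_zero]
  refine radial_system_eq_zero hs (n := n)
    (v := fun m t => ladderLift u' (-n) a' b' c' d' * radialPart u a b c d n m t -
      ladderLift u (-n) a b c d * radialPart u' a' b' c' d' n m t) ?_ ?_ ?_ ?_ m ht
  · intro m t
    refine (((hu.hasDerivAt_radialPart h n m t).const_mul _).sub
      ((hu'.hasDerivAt_radialPart h' n m t).const_mul _)).congr_deriv ?_
    ring
  · intro m t
    linear_combination ladderLift u' (-n) a' b' c' d' * hu.radialPart_relation h n m t -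
      ladderLift u (-n) a b c d * hu'.radialPart_relation h' n m t
  · simp only [radialPart_zero u h, radialPart_zero u' h', if_true]
    ring
  · simp [radialPart_zero u h, radialPart_zero u' h']

lemma deriv_fst_of_angular {F : ℝ → ℝ → ℝ → ℂ} {m : ℤ}
    (hF : ∀ x y θ, 0 < y → F x y θ = exp (2 * m * θ * I) * F x y 0) (x : ℝ) {y : ℝ} (hy : 0 < y)
    (θ : ℝ) :
    deriv (fun t => F t y θ) x = exp (2 * m * θ * I) * deriv (fun t => F t y 0) x := by
  rw [← deriv_const_mul_field]
  exact congrArg (deriv · x) (funext fun t => hF t y θ hy)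

lemma deriv_snd_of_angular {F : ℝ → ℝ → ℝ → ℂ} {m : ℤ}
    (hF : ∀ x y θ, 0 < y → F x y θ = exp (2 * m * θ * I) * F x y 0) (x : ℝ) {y : ℝ} (hy : 0 < y)
    (θ : ℝ) :
    deriv (fun t => F x t θ) y = exp (2 * m * θ * I) * deriv (fun t => F x t 0) y := by
  rw [← deriv_const_mul_field]
  refine Filter.EventuallyEq.deriv_eq ?_
  filter_upwards [lt_mem_nhds hy] with t ht using hF x t θ ht

lemma deriv_angle_of_angular {F : ℝ → ℝ → ℝ → ℂ} {m : ℤ}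
    (hF : ∀ x y θ, 0 < y → F x y θ = exp (2 * m * θ * I) * F x y 0) (x : ℝ) {y : ℝ} (hy : 0 < y)
    (θ : ℝ) :
    deriv (fun t => F x y t) θ = 2 * m * I * exp (2 * m * θ * I) * F x y 0 := by
  refine (congrArg (deriv · θ) (funext fun t => hF x y t hy)).trans
    (((((((hasDerivAt_id θ).ofReal_comp).const_mul (2 * (m : ℂ))).mul_const I).cexp).mul_const
    (F x y 0)).congr_deriv ?_).deriv
  simp only [id, ofReal_one]
  ring

lemma Eplus_of_angular {F : ℝ → ℝ → ℝ → ℂ} {m : ℤ}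
    (hF : ∀ x y θ, 0 < y → F x y θ = exp (2 * m * θ * I) * F x y 0) (x : ℝ) {y : ℝ} (hy : 0 < y)
    (θ : ℝ) :
    Eplus F x y θ = exp (2 * (m + 1) * θ * I) * (2 * (I * y * deriv (fun t => F t y 0) x +
      y * deriv (fun t => F x t 0) y + m * F x y 0)) := by
  have h1 : exp (2 * (m + 1) * θ * I) =
      (Real.cos (2 * θ) + Real.sin (2 * θ) * I) * exp (2 * m * θ * I) := by
    rw [show (2 * (m + 1) * θ * I : ℂ) = ((2 * θ : ℝ) : ℂ) * I + 2 * m * θ * I by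
      push_cast; ring, exp_add, exp_mul_I]
    simp
  have h3 : (Real.sin θ ^ 2 : ℂ) = (1 - Real.cos (2 * θ)) / 2 := by
    have := Real.cos_two_mul θ
    have h4 := Real.sin_sq_add_cos_sq θ
    norm_cast
    linear_combination h4 + this / 2
  rw [Eplus, Hop, Xop, Wop, deriv_fst_of_angular hF x hy, deriv_snd_of_angular hF x hy,
    deriv_angle_of_angular hF x hy, h1, h3]
  linear_combination (-2 * deriv (fun t => F t y 0) x * y * Real.sin (2 * θ) -
    2 * m * F x y 0 * Real.cos (2 * θ)) * exp (2 * m * θ * I) * I_sq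

lemma Eminus_of_angular {F : ℝ → ℝ → ℝ → ℂ} {m : ℤ}
    (hF : ∀ x y θ, 0 < y → F x y θ = exp (2 * m * θ * I) * F x y 0) (x : ℝ) {y : ℝ} (hy : 0 < y)
    (θ : ℝ) :
    Eminus F x y θ = exp (2 * (m - 1) * θ * I) * (2 * (-(I * y * deriv (fun t => F t y 0) x) +
      y * deriv (fun t => F x t 0) y - m * F x y 0)) := by
  have h1 : exp (2 * (m - 1) * θ * I) =
      (Real.cos (2 * θ) - Real.sin (2 * θ) * I) * exp (2 * m * θ * I) := by
    rw [show (2 * (m - 1) * θ * I : ℂ) = ((-(2 * θ) : ℝ) : ℂ) * I + 2 * m * θ * I by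
      push_cast; ring, exp_add, exp_mul_I]
    simp [sub_eq_add_neg]
  have h3 : (Real.sin θ ^ 2 : ℂ) = (1 - Real.cos (2 * θ)) / 2 := by
    have := Real.cos_two_mul θ
    have h4 := Real.sin_sq_add_cos_sq θ
    norm_cast
    linear_combination h4 + this / 2
  rw [Eminus, Hop, Xop, Wop, deriv_fst_of_angular hF x hy, deriv_snd_of_angular hF x hy,
    deriv_angle_of_angular hF x hy, h1, h3]
  linear_combination (-2 * deriv (fun t => F t y 0) x * y * Real.sin (2 * θ) +
    2 * m * F x y 0 * Real.cos (2 * θ)) * exp (2 * m * θ * I) * I_sq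

lemma spectralParam_add_int_ne_zero (r : ℝ) (m : ℤ) : (r * I + 1 / 2 : ℂ) + m ≠ 0 := by
  intro h
  have h1 := congrArg re h
  simp at h1
  have h2 : (1 + 2 * m : ℤ) = 0 := by
    have : (1 + 2 * m : ℝ) = 0 := by linarith
    exact_mod_cast this
  omega

lemma angular_of_recursion {Φ : ℤ → ℝ → ℝ → ℝ → ℂ} {P M : ℤ → ℂ}
    (h0 : ∀ x y θ, 0 < y → Φ 0 x y θ = Φ 0 x y 0)
    (hp : ∀ n x y θ, 0 < y → Φ (n + 1) x y θ = Eplus (Φ n) x y θ / P n)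
    (hm : ∀ n x y θ, 0 < y → Φ (n - 1) x y θ = Eminus (Φ n) x y θ / M n) (n : ℤ) :
    ∀ x y θ, 0 < y → Φ n x y θ = exp (2 * n * θ * I) * Φ n x y 0 := by
  induction n using Int.induction_on with
  | zero => simpa using h0
  | succ n ih =>
    intro x y θ hy
    rw [hp _ _ _ _ hy, hp _ _ _ _ hy, Eplus_of_angular ih x hy, Eplus_of_angular ih x hy]
    simp [mul_div_assoc]
  | pred n ih =>
    intro x y θ hy
    rw [hm _ _ _ _ hy, hm _ _ _ _ hy, Eminus_of_angular ih x hy, Eminus_of_angular ih x hy]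
    simp [mul_div_assoc]

lemma isLadder_of_recursion {r : ℝ} {Φ : ℤ → ℝ → ℝ → ℝ → ℂ}
    (hΦ : ∀ n : ℤ, ContDiffOn ℝ (⊤ : ℕ∞)
      (fun p : ℝ × ℝ × ℝ => Φ n p.1 p.2.1 p.2.2) {p : ℝ × ℝ × ℝ | 0 < p.2.1})
    (hang : ∀ n : ℤ, ∀ x y θ : ℝ, 0 < y → Φ n x y θ = exp (2 * n * θ * I) * Φ n x y 0)
    (hp : ∀ n : ℤ, ∀ x y θ : ℝ, 0 < y →
      Φ (n + 1) x y θ = Eplus (Φ n) x y θ / (2 * r * I + 1 + 2 * n))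
    (hm : ∀ n : ℤ, ∀ x y θ : ℝ, 0 < y →
      Φ (n - 1) x y θ = Eminus (Φ n) x y θ / (2 * r * I + 1 - 2 * n)) :
    IsLadder (r * I + 1 / 2) fun n x y => Φ n x y 0 := by
  intro m x y hy
  have hopen : IsOpen {p : ℝ × ℝ × ℝ | 0 < p.2.1} := isOpen_lt (by fun_prop) (by fun_prop)
  have hd : DifferentiableAt ℝ (fun p : ℝ × ℝ × ℝ => Φ m p.1 p.2.1 p.2.2) (x, y, 0) :=
    ((hΦ m).contDiffAt (hopen.mem_nhds hy)).differentiableAt (by simp)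
  have hd' : DifferentiableAt ℝ (fun p : ℝ × ℝ => Φ m p.1 p.2 0) (x, y) :=
    DifferentiableAt.comp (x := (x, y)) (g := fun p : ℝ × ℝ × ℝ => Φ m p.1 p.2.1 p.2.2)
      (f := fun p : ℝ × ℝ => (p.1, p.2, (0 : ℝ))) hd (by fun_prop)
  obtain ⟨L, hL⟩ := hd'
  have h1 : deriv (fun t => Φ m t y 0) x = L (1, 0) :=
    (HasFDerivAt.comp_hasDerivAt (f := fun t : ℝ => (t, y)) x hL
      ((hasDerivAt_id x).prodMk (hasDerivAt_const x y))).deriv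
  have h2 : deriv (fun t => Φ m x t 0) y = L (0, 1) :=
    (HasFDerivAt.comp_hasDerivAt (f := fun t : ℝ => (x, t)) y hL
      ((hasDerivAt_const y x).prodMk (hasDerivAt_id y))).deriv
  have hpos := spectralParam_add_int_ne_zero r m
  have hneg := spectralParam_add_int_ne_zero r (-m)
  refine ⟨L, hL, ?_, ?_⟩ <;> beta_reduce
  · rw [hp m x y 0 hy, Eplus_of_angular (hang m) x hy, h1, h2,
      show (2 * r * I + 1 + 2 * m : ℂ) = 2 * (r * I + 1 / 2 + m) by ring]
    generalize (r * I + 1 / 2 + m : ℂ) = k at hpos ⊢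
    field_simp
    simp
  · rw [hm m x y 0 hy, Eminus_of_angular (hang m) x hy, h1, h2,
      show (2 * r * I + 1 - 2 * m : ℂ) = 2 * (r * I + 1 / 2 + (-m : ℤ)) by push_cast; ring,
      show (r * I + 1 / 2 - m : ℂ) = r * I + 1 / 2 + (-m : ℤ) by push_cast; ring]
    generalize (r * I + 1 / 2 + (-m : ℤ) : ℂ) = k at hneg ⊢
    field_simp
    simp

lemma isLadder_cpow (s : ℂ) : IsLadder s fun _ _ y => exp (s * log y) := by
  intro m x y hy
  have hder : HasDerivAt (fun t : ℝ => exp (s * log t)) (exp (s * log y) * (s * (1 / y))) y := by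
    have := ((hasDerivAt_id y).ofReal_comp.clog_real (Or.inl (by simpa using hy))).const_mul s
    simpa using this.cexp
  have hL := HasFDerivAt.comp (g := fun t : ℝ => exp (s * log t)) (x, y) hder.hasFDerivAt
    (hasFDerivAt_snd (𝕜 := ℝ) (E := ℝ) (F := ℝ))
  have hy' : (y : ℂ) ≠ 0 := by exact_mod_cast hy.ne'
  refine ⟨_, hL, ?_, ?_⟩
  · simp; field_simp
  · simp; field_simp

/-- The rotation `kMat α` as an element of `SL(2, ℝ)`. -/
def rot (α : ℝ) : Matrix.SpecialLinearGroup (Fin 2) ℝ :=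
  ⟨kMat α, by simp [kMat, Matrix.det_fin_two_of, ← sq]⟩

/-- The matrix `pMat x y` as an element of `SL(2, ℝ)`. -/
def pSL (x : ℝ) {y : ℝ} (hy : 0 < y) : Matrix.SpecialLinearGroup (Fin 2) ℝ :=
  ⟨pMat x y, by simp [pMat, Matrix.det_fin_two_of, (Real.sqrt_pos.2 hy).ne']⟩

/-- The point `e^{2t} i`. -/
def expI (t : ℝ) : UpperHalfPlane :=
  ⟨Real.exp (2 * t) * I, by rw [mul_I_im, ofReal_re]; exact Real.exp_pos _⟩

lemma moebius_coe (g : Matrix.SpecialLinearGroup (Fin 2) ℝ) (z : UpperHalfPlane) :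
    moebius g z = ↑(g • z) := by
  rw [UpperHalfPlane.coe_specialLinearGroup_apply]
  simp [moebius]

lemma rot_add (α β : ℝ) : rot (α + β) = rot α * rot β := by
  refine Subtype.ext (show kMat (α + β) = kMat α * kMat β from ?_)
  ext i j
  fin_cases i <;> fin_cases j <;> simp [kMat, Real.cos_add, Real.sin_add] <;> ring

lemma rot_neg (α : ℝ) : rot (-α) = (rot α)⁻¹ := by
  rw [eq_inv_iff_mul_eq_one, ← rot_add, neg_add_cancel]
  ext i j
  fin_cases i <;> fin_cases j <;> simp [rot, kMat]

lemma continuous_rot : Continuous rot := by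
  refine Continuous.subtype_mk (continuous_matrix fun i j => ?_) _
  fin_cases i <;> fin_cases j <;> simp [kMat] <;> fun_prop

lemma rot_pi_div_two_smul (z : UpperHalfPlane) :
    ((rot (Real.pi / 2) • z : UpperHalfPlane) : ℂ) = -(z : ℂ)⁻¹ := by
  rw [← moebius_coe]
  simp [moebius, rot, kMat, ← inv_neg]

lemma exists_rot_smul_expI (w : UpperHalfPlane) :
    ∃ β t : ℝ, 0 ≤ t ∧ w = rot β • expI t := by
  suffices h : ∃ β t : ℝ, 0 ≤ t ∧ ((rot β • w : UpperHalfPlane) : ℂ) = Real.exp (2 * t) * I by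
    obtain ⟨β, t, ht, h⟩ := h
    refine ⟨-β, t, ht, ?_⟩
    rw [rot_neg, eq_inv_smul_iff]
    exact UpperHalfPlane.ext h
  have hcont : Continuous fun β => (rot β • w).re :=
    UpperHalfPlane.continuous_re.comp (continuous_rot.smul continuous_const)
  have hsign : (rot 0 • w).re * (rot (Real.pi / 2) • w).re ≤ 0 := by
    have h0 : rot 0 • w = w := by
      have := rot_add 0 0
      simp at this
      rw [this, one_smul]
    have h1 : (rot (Real.pi / 2) • w).re = -(w.re / normSq w) := by
      have := congrArg re (rot_pi_div_two_smul w)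
      simpa [div_eq_mul_inv] using this
    rw [h0, h1]
    have := normSq_nonneg (w : ℂ)
    have : w.re * -(w.re / normSq w) = -(w.re ^ 2 / normSq w) := by ring
    rw [this]
    have : 0 ≤ w.re ^ 2 / normSq w := by positivity
    linarith
  obtain ⟨β, -, hβ⟩ : ∃ β ∈ Set.uIcc 0 (Real.pi / 2), (rot β • w).re = 0 := by
    have := intermediate_value_uIcc (hcont.continuousOn (s := Set.uIcc 0 (Real.pi / 2)))
    refine this ?_
    rw [Set.mem_uIcc]
    rcases mul_nonpos_iff.1 hsign with h | h
    · exact Or.inr h.symm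
    · exact Or.inl h
  have key : ((rot β • w : UpperHalfPlane) : ℂ) = (rot β • w).im * I := by
    apply Complex.ext <;> simp [hβ]
  set v := rot β • w with hv
  rcases le_total 1 v.im with h | h
  · refine ⟨β, Real.log v.im / 2, div_nonneg (Real.log_nonneg h) two_pos.le, ?_⟩
    rw [mul_div_cancel₀ _ two_ne_zero, Real.exp_log v.im_pos, ← hv, key]
  · refine ⟨Real.pi / 2 + β, -Real.log v.im / 2,
      div_nonneg (neg_nonneg.2 (Real.log_nonpos v.im_pos.le h)) two_pos.le, ?_⟩
    rw [mul_div_cancel₀ _ two_ne_zero, Real.exp_neg, Real.exp_log v.im_pos, rot_add, mul_smul, ← hv,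
      rot_pi_div_two_smul, key]
    simp [mul_comm]

lemma coe_mul_rot (g : Matrix.SpecialLinearGroup (Fin 2) ℝ) (α : ℝ) :
    ((g * rot α : Matrix.SpecialLinearGroup (Fin 2) ℝ) : Matrix (Fin 2) (Fin 2) ℝ) =
      !![g 0 0 * Real.cos α - g 0 1 * Real.sin α, g 0 0 * Real.sin α + g 0 1 * Real.cos α;
        g 1 0 * Real.cos α - g 1 1 * Real.sin α, g 1 0 * Real.sin α + g 1 1 * Real.cos α] := by
  rw [Matrix.SpecialLinearGroup.coe_mul]
  ext i j
  fin_cases i <;> fin_cases j <;>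
    simp [rot, kMat, Matrix.mul_apply, Fin.sum_univ_two, sub_eq_add_neg]

lemma rot_add_pi_smul (α : ℝ) (w : UpperHalfPlane) : rot (α + Real.pi) • w = rot α • w := by
  apply UpperHalfPlane.ext
  rw [← moebius_coe, ← moebius_coe]
  simp only [moebius, rot, kMat, Real.cos_add_pi, Real.sin_add_pi]
  rw [← neg_div_neg_eq]
  congr 1 <;> simp <;> ring

lemma periodic_exp_two_int_mul (n : ℤ) :
    Function.Periodic (fun α : ℝ => exp (2 * n * α * I)) Real.pi := by
  intro α
  dsimp only
  rw [show (2 * n * (α + Real.pi : ℝ) * I : ℂ) = 2 * n * α * I + n * (2 * Real.pi * I) by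
    push_cast; ring, exp_add, exp_int_mul_two_pi_mul_I, mul_one]

lemma polarLift_zero_eq {u : ℤ → ℝ → ℝ → ℂ} {ψ : ℂ → ℂ}
    (hψ : ∀ x y : ℝ, 0 < y → u 0 x y = ψ (x + y * I))
    (g : Matrix.SpecialLinearGroup (Fin 2) ℝ) (α t : ℝ) :
    polarLift u (g 0 0) (g 0 1) (g 1 0) (g 1 1) 0 α t = ψ ↑((g * rot α) • expI t) := by
  have hdet : g 0 0 * g 1 1 - g 0 1 * g 1 0 = 1 := by
    rw [← Matrix.det_fin_two, g.det_coe]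
  have h1 := polar_det hdet α t
  have hN := sq_add_sq_pos_of_det h1
  rw [← moebius_coe]
  simp only [polarLift, ladderLift, zpow_zero, mul_one]
  rw [hψ _ _ (one_div_pos.2 hN)]
  congr 1
  have he : Real.exp (2 * t) = Real.exp t * Real.exp t := by rw [← Real.exp_add]; ring_nf
  have he1 : Real.exp t * Real.exp (-t) = 1 := by rw [← Real.exp_add]; simp
  have e : ∀ A B : ℝ, (A : ℂ) * (Real.exp (2 * t) * I) + B =
      Real.exp t * ((A * Real.exp t : ℝ) * I + (B * Real.exp (-t) : ℝ)) := by
    intro A B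
    have : (Real.exp t * Real.exp (-t) : ℂ) = 1 := by exact_mod_cast he1
    rw [he]
    push_cast [-ofReal_exp]
    linear_combination -(B : ℂ) * this
  simp only [moebius, expI]
  rw [coe_mul_rot]
  simp only [Matrix.of_apply, Matrix.cons_val', Matrix.cons_val_zero, Matrix.cons_val_one,
    Matrix.cons_val_fin_one]
  rw [e, e, mul_div_mul_left _ _ (by exact_mod_cast (Real.exp_pos t).ne')]
  generalize (g 0 0 * Real.cos α - g 0 1 * Real.sin α) * Real.exp t = A at *
  generalize (g 0 0 * Real.sin α + g 0 1 * Real.cos α) * Real.exp (-t) = B at *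
  generalize (g 1 0 * Real.cos α - g 1 1 * Real.sin α) * Real.exp t = C at *
  generalize (g 1 0 * Real.sin α + g 1 1 * Real.cos α) * Real.exp (-t) = D at *
  have hd := add_mul_I_ne_zero hN
  rw [add_comm (D : ℂ)] at hd
  have hN' : ((C ^ 2 + D ^ 2 : ℝ) : ℂ) ≠ 0 := by exact_mod_cast hN.ne'
  have h1' : (A * D - B * C : ℂ) = 1 := by exact_mod_cast h1
  rw [eq_div_iff hd, ofReal_div, ofReal_div, div_mul_eq_mul_div, ← add_div, div_mul_eq_mul_div,
    div_eq_iff hN']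
  push_cast
  linear_combination (-(D * I) - C * I ^ 2) * h1' + (A * D * C - B * C ^ 2) * I_sq

lemma integral_smul_eq_radialPart {u : ℤ → ℝ → ℝ → ℂ} {ψ : ℂ → ℂ}
    (hψ : ∀ x y : ℝ, 0 < y → u 0 x y = ψ (x + y * I))
    (g : Matrix.SpecialLinearGroup (Fin 2) ℝ) (n : ℤ) (β t : ℝ) :
    ∫ α in (0 : ℝ)..Real.pi, ψ ↑((g * rot α) • rot β • expI t) * exp (2 * n * α * I) =
      exp (-(2 * n * β * I)) * radialPart u (g 0 0) (g 0 1) (g 1 0) (g 1 1) n 0 t := by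
  set Q : ℝ → ℂ := fun α =>
    polarLift u (g 0 0) (g 0 1) (g 1 0) (g 1 1) 0 α t * exp (2 * n * α * I) with hQ
  have hper : Function.Periodic Q Real.pi :=
    Function.Periodic.mul (fun α => polarLift_add_pi u _ _ _ _ 0 α t) (periodic_exp_two_int_mul n)
  have h1 : ∀ α : ℝ, ψ ↑((g * rot α) • rot β • expI t) * exp (2 * n * α * I) =
      exp (-(2 * n * β * I)) * Q (α + β) := by
    intro α
    simp only [hQ]
    rw [polarLift_zero_eq hψ, rot_add, ← mul_assoc g, mul_smul (g * rot α), mul_left_comm,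
      ← exp_add]
    congr 2
    push_cast
    ring
  simp only [h1, intervalIntegral.integral_const_mul, radialPart]
  rw [intervalIntegral.integral_comp_add_right, zero_add, add_comm Real.pi,
    hper.intervalIntegral_add_eq _ 0]
  simp [hQ]

lemma sphFn_neg_eq (r : ℝ) (n : ℤ) (w : UpperHalfPlane) :
    sphFn r (-n) w = (1 / Real.pi : ℂ) *
      ∫ α in (0 : ℝ)..Real.pi, phir r ↑(rot α • w) * exp (2 * n * α * I) := by
  rw [sphFn]
  congr 1
  set Q : ℝ → ℂ := fun α => phir r ↑(rot α • w) * exp (2 * n * α * I) with hQ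
  have hper : Function.Periodic Q Real.pi :=
    Function.Periodic.mul (fun α => by rw [rot_add_pi_smul]) (periodic_exp_two_int_mul n)
  have h1 : ∀ θ : ℝ, phir r (moebius (kMat (-θ)) w) * exp (2 * (-n : ℤ) * θ * I) = Q (-θ) := by
    intro θ
    simp only [hQ]
    rw [← moebius_coe]
    congr 2
    push_cast
    ring
  simp only [h1]
  rw [intervalIntegral.integral_comp_neg]
  simpa using hper.intervalIntegral_add_eq (-Real.pi) 0

lemma ladderLift_cpow_one (s : ℂ) (n : ℤ) :
    ladderLift (fun _ _ y => exp (s * log y)) n 1 0 0 1 = 1 := by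
  simp [ladderLift]

lemma IsLadder.integral_smul_eq {r : ℝ} {u : ℤ → ℝ → ℝ → ℂ} (hu : IsLadder (r * I + 1 / 2) u)
    {ψ : ℂ → ℂ} (hψ : ∀ x y : ℝ, 0 < y → u 0 x y = ψ (x + y * I))
    (g : Matrix.SpecialLinearGroup (Fin 2) ℝ) (n : ℤ) (w : UpperHalfPlane) :
    (1 / Real.pi : ℂ) * ∫ α in (0 : ℝ)..Real.pi, ψ ↑((g * rot α) • w) * exp (2 * n * α * I) =
      ladderLift u (-n) (g 0 0) (g 0 1) (g 1 0) (g 1 1) * sphFn r (-n) w := by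
  obtain ⟨β, t, ht, rfl⟩ := exists_rot_smul_expI w
  have hdet : g 0 0 * g 1 1 - g 0 1 * g 1 0 = 1 := by
    rw [← Matrix.det_fin_two, g.det_coe]
  have h1 := integral_smul_eq_radialPart (u := fun _ _ y => exp ((r * I + 1 / 2) * log y))
    (ψ := phir r) (fun x y _ => by simp [phir]) 1 n β t
  simp only [one_mul] at h1
  have key := hu.radialPart_eq (spectralParam_add_int_ne_zero r) (isLadder_cpow _) hdet
    (show (1 : ℝ) * 1 - 0 * 0 = 1 by norm_num) n 0 ht
  rw [ladderLift_cpow_one, one_mul] at key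
  rw [sphFn_neg_eq, integral_smul_eq_radialPart hψ, h1, key]
  simp
  ring

lemma ladderLift_pSL_mul_rot (u : ℤ → ℝ → ℝ → ℂ) (n : ℤ) (x θ : ℝ) {y : ℝ} (hy : 0 < y)
    {g : Matrix.SpecialLinearGroup (Fin 2) ℝ} (hg : g = pSL x hy * rot θ) :
    ladderLift u n (g 0 0) (g 0 1) (g 1 0) (g 1 1) = exp (2 * n * θ * I) * u n x y := by
  have hs := (Real.sqrt_pos.2 hy).ne'
  have hs2 := Real.sq_sqrt hy.le
  have hsc : ((√y : ℝ) : ℂ) ≠ 0 := by exact_mod_cast hs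
  have h2 := Real.sin_sq_add_cos_sq θ
  rw [hg, coe_mul_rot]
  simp only [Matrix.of_apply, Matrix.cons_val', Matrix.cons_val_zero, Matrix.cons_val_one,
    Matrix.cons_val_fin_one, pSL, pMat, ladderLift]
  have hN : (0 * Real.cos θ - 1 / √y * Real.sin θ) ^ 2 +
      (0 * Real.sin θ + 1 / √y * Real.cos θ) ^ 2 = 1 / y := by
    rw [← hs2, Real.sqrt_sq (Real.sqrt_nonneg y)]
    field_simp
    linear_combination h2
  have hX : (√y * Real.cos θ - x / √y * Real.sin θ) * (0 * Real.cos θ - 1 / √y * Real.sin θ) +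
      (√y * Real.sin θ + x / √y * Real.cos θ) * (0 * Real.sin θ + 1 / √y * Real.cos θ) =
      x / y := by
    rw [← hs2, Real.sqrt_sq (Real.sqrt_nonneg y)]
    field_simp
    linear_combination x * h2
  have e3 : exp (2 * n * θ * I) = (exp (θ * I) / exp (-(θ * I))) ^ n := by
    rw [← exp_sub, ← exp_int_mul]; congr 1; ring
  have e4 : exp (θ * I) = Real.cos θ + Real.sin θ * I := by
    rw [exp_mul_I]; push_cast; rfl
  have e5 : exp (-(θ * I)) = Real.cos θ - Real.sin θ * I := by
    rw [← neg_mul, exp_mul_I]; simp; ring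
  rw [hN, hX, e3, e4, e5, mul_comm]
  congr 2
  · refine .trans ?_ (mul_div_mul_left _ _ (one_div_ne_zero hsc))
    congr 1 <;> push_cast <;> ring
  · field_simp
  · field_simp

lemma hypMeasure_eq_map : hypMeasure = Measure.map UpperHalfPlane.coe volume := by
  have hrange : Set.range UpperHalfPlane.coe = {z : ℂ | 0 < z.im} := by
    ext z
    exact ⟨fun ⟨w, hw⟩ => hw ▸ w.im_pos, fun hz => ⟨⟨z, hz⟩, rfl⟩⟩
  have hU : MeasurableSet {z : ℂ | 0 < z.im} := measurableSet_lt (by fun_prop) (by fun_prop)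
  ext s hs
  rw [UpperHalfPlane.measurableEmbedding_coe.map_apply, UpperHalfPlane.volume_eq_lintegral,
    Set.image_preimage_eq_inter_range, hrange, hypMeasure, Measure.restrict_apply hs,
    withDensity_apply _ (hs.inter hU)]
  refine setLIntegral_congr_fun (hs.inter hU) fun z hz => ?_
  have hz' : 0 < z.im := hz.2
  simp only [ENNReal.ofReal, one_div]
  congr 1
  ext
  rw [Real.coe_toNNReal _ (by positivity)]
  simp

lemma integral_hypMeasure (F : ℂ → ℂ) :
    ∫ z, F z ∂hypMeasure = ∫ w : UpperHalfPlane, F w := by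
  rw [hypMeasure_eq_map, UpperHalfPlane.measurableEmbedding_coe.integral_map]

lemma integral_smul_SL (g : Matrix.SpecialLinearGroup (Fin 2) ℝ) (F : UpperHalfPlane → ℂ) :
    ∫ w : UpperHalfPlane, F (g • w) = ∫ w, F w :=
  integral_smul_eq_self (μ := (volume : Measure UpperHalfPlane)) F
    (g := (g : Matrix.GeneralLinearGroup (Fin 2) ℝ))

lemma integrable_smul_kernel {f ψ : ℂ → ℂ} (hf : Continuous f) (hfc : HasCompactSupport f)
    (hfs : tsupport f ⊆ {z : ℂ | 0 < z.im}) (hψ : ContinuousOn ψ {z : ℂ | 0 < z.im})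
    (g : Matrix.SpecialLinearGroup (Fin 2) ℝ) (n : ℤ) :
    Integrable (Function.uncurry fun (α : ℝ) (w : UpperHalfPlane) =>
      f w * (ψ ↑((g * rot α) • w) * exp (2 * n * α * I)))
      ((volume.restrict (Set.uIoc 0 Real.pi)).prod volume) := by
  set K : Set UpperHalfPlane := UpperHalfPlane.coe ⁻¹' tsupport f with hK
  have hKc : IsCompact K := by
    refine UpperHalfPlane.isOpenEmbedding_coe.isInducing.isCompact_preimage' hfc ?_
    exact fun z hz => ⟨⟨z, hfs hz⟩, rfl⟩
  have hψ' : Continuous fun w : UpperHalfPlane => ψ w :=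
    hψ.comp_continuous UpperHalfPlane.continuous_coe fun w => w.im_pos
  have hcont : Continuous (Function.uncurry fun (α : ℝ) (w : UpperHalfPlane) =>
      f w * (ψ ↑((g * rot α) • w) * exp (2 * n * α * I))) := by
    refine Continuous.mul (hf.comp (UpperHalfPlane.continuous_coe.comp continuous_snd)) ?_
    refine Continuous.mul (hψ'.comp ?_) (by fun_prop)
    exact (continuous_const.mul (continuous_rot.comp continuous_fst)).smul continuous_snd
  have hi : IntegrableOn (Function.uncurry fun (α : ℝ) (w : UpperHalfPlane) =>
      f w * (ψ ↑((g * rot α) • w) * exp (2 * n * α * I)))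
      (Set.uIcc 0 Real.pi ×ˢ K) ((volume : Measure ℝ).prod volume) :=
    hcont.continuousOn.integrableOn_compact (isCompact_uIcc.prod hKc)
  have hi' := hi.mono_set (Set.prod_mono_left Set.uIoc_subset_uIcc)
  rw [IntegrableOn, ← Measure.prod_restrict] at hi'
  rw [show ((volume.restrict (Set.uIoc 0 Real.pi)).prod (volume : Measure UpperHalfPlane)) =
    ((volume.restrict (Set.uIoc 0 Real.pi)).prod ((volume : Measure UpperHalfPlane).restrict
      Set.univ)) by rw [Measure.restrict_univ]]
  rw [Measure.prod_restrict] at hi' ⊢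
  refine IntegrableOn.of_forall_sdiff_eq_zero hi' (measurableSet_uIoc.prod .univ) ?_
  rintro ⟨α, w⟩ hw
  have : (w : ℂ) ∉ tsupport f := fun h => hw.2 ⟨hw.1.1, h⟩
  simp [image_eq_zero_of_notMem_tsupport this]

/-- The convolution of the bottom function of a ladder family with a function of angular type `n`
is the spherical transform times the lift of the family in degree `-n`. -/
lemma IsLadder.integral_inv_smul_mul {r : ℝ} {u : ℤ → ℝ → ℝ → ℂ} (hu : IsLadder (r * I + 1 / 2) u)
    {ψ : ℂ → ℂ} (hψc : ContinuousOn ψ {z : ℂ | 0 < z.im})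
    (hψ : ∀ x y : ℝ, 0 < y → u 0 x y = ψ (x + y * I)) {n : ℤ} {f : ℂ → ℂ}
    (hf : Continuous f) (hfc : HasCompactSupport f) (hfs : tsupport f ⊆ {z : ℂ | 0 < z.im})
    (hfn : ∀ α : ℝ, ∀ z : ℂ, 0 < z.im → f (moebius (kMat α) z) = exp (2 * n * α * I) * f z)
    (g : Matrix.SpecialLinearGroup (Fin 2) ℝ) :
    ∫ w : UpperHalfPlane, f ↑(g⁻¹ • w) * ψ w =
      sphTransform n f r * ladderLift u (-n) (g 0 0) (g 0 1) (g 1 0) (g 1 1) := by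
  have hrot : ∀ α : ℝ, ∫ w : UpperHalfPlane, f ↑(g⁻¹ • w) * ψ w =
      ∫ w : UpperHalfPlane, f w * (ψ ↑((g * rot α) • w) * exp (2 * n * α * I)) := by
    intro α
    rw [← integral_smul_SL (g * rot α)]
    congr 1
    ext w
    rw [← mul_smul, inv_mul_cancel_left, ← moebius_coe, show (rot α : Matrix _ _ ℝ) = kMat α from rfl,
      hfn α w w.im_pos]
    ring
  have hpi : (Real.pi : ℂ) ≠ 0 := by exact_mod_cast Real.pi_ne_zero
  have havg : ∫ w : UpperHalfPlane, f ↑(g⁻¹ • w) * ψ w = (1 / Real.pi : ℂ) *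
      ∫ α in (0 : ℝ)..Real.pi,
        ∫ w : UpperHalfPlane, f w * (ψ ↑((g * rot α) • w) * exp (2 * n * α * I)) := by
    simp only [← hrot]
    simp [hpi]
  rw [havg, intervalIntegral_integral_swap (integrable_smul_kernel hf hfc hfs hψc g n),
    ← integral_const_mul, sphTransform, integral_hypMeasure, ← integral_mul_const]
  congr 1
  ext w
  rw [intervalIntegral.integral_const_mul, mul_left_comm, hu.integral_smul_eq hψ]
  ring

/-- Let `φ` be a smooth eigenfunction of the hyperbolic Laplacian with eigenvalue
`−(1/4 + r²)`, and let `(φ_n)_{n∈ℤ}` be the family obtained from `φ_0(x,y,θ) = φ(x+iy)`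
by the recursions `φ_{n±1} = E^±φ_n/(2ir+1±2n)`.  Then for every `n` and every smooth,
compactly supported `f : ℍ → ℂ` with `f(k_α·z) = e^{2inα}f(z)`, one has
`∫_ℍ f((p_{x+iy}k_θ)⁻¹·w)·φ(w) dμ(w) = 𝒮_n f(r) · φ_{−n}(x,y,θ)`. -/
theorem convolution_of_eigenfunction_family (r : ℝ) (φ : ℂ → ℂ)
    (hφ : ContDiffOn ℝ (⊤ : ℕ∞) φ {z : ℂ | 0 < z.im})
    (heig : ∀ x y : ℝ, 0 < y →
      (y : ℂ) ^ 2 *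
          (deriv (fun x' : ℝ => deriv (fun x'' : ℝ => φ (x'' + y * Complex.I)) x') x
            + deriv (fun y' : ℝ => deriv (fun y'' : ℝ => φ (x + y'' * Complex.I)) y') y)
        = -((1 : ℂ) / 4 + (r : ℂ) ^ 2) * φ (x + y * Complex.I))
    (Φ : ℤ → ℝ → ℝ → ℝ → ℂ)
    (hΦsmooth : ∀ n : ℤ, ContDiffOn ℝ (⊤ : ℕ∞)
      (fun p : ℝ × ℝ × ℝ => Φ n p.1 p.2.1 p.2.2) {p : ℝ × ℝ × ℝ | 0 < p.2.1})
    (hΦ0 : ∀ x y θ : ℝ, Φ 0 x y θ = φ (x + y * Complex.I))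
    (hrecPlus : ∀ n : ℤ, ∀ x y θ : ℝ, 0 < y →
      Φ (n + 1) x y θ = Eplus (Φ n) x y θ / (2 * r * Complex.I + 1 + 2 * n))
    (hrecMinus : ∀ n : ℤ, ∀ x y θ : ℝ, 0 < y →
      Φ (n - 1) x y θ = Eminus (Φ n) x y θ / (2 * r * Complex.I + 1 - 2 * n)) :
    ∀ n : ℤ, ∀ f : ℂ → ℂ, ContDiff ℝ (⊤ : ℕ∞) f → HasCompactSupport f →
      tsupport f ⊆ {z : ℂ | 0 < z.im} →
      (∀ α : ℝ, ∀ z : ℂ, 0 < z.im →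
        f (moebius (kMat α) z) = Complex.exp (2 * n * α * Complex.I) * f z) →
      ∀ x y θ : ℝ, 0 < y →
        ∫ w, f (moebius ((pMat x y * kMat θ)⁻¹) w) * φ w ∂hypMeasure
          = sphTransform n f r * Φ (-n) x y θ := by
  intro n f hf hfc hfs hfn x y θ hy
  have hang := angular_of_recursion (fun x y θ _ => by rw [hΦ0, hΦ0]) hrecPlus hrecMinus
  have hu := isLadder_of_recursion hΦsmooth hang hrecPlus hrecMinus
  have key := hu.integral_inv_smul_mul hφ.continuousOn (fun x y _ => hΦ0 x y 0) hf.continuous hfc hfs hfn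
    (pSL x hy * rot θ)
  rw [ladderLift_pSL_mul_rot _ _ x θ hy rfl, ← hang (-n) x y θ hy] at key
  have hinv : (pMat x y * kMat θ)⁻¹ =
      ((pSL x hy * rot θ)⁻¹ : Matrix.SpecialLinearGroup (Fin 2) ℝ) := by
    refine Matrix.inv_eq_left_inv ?_
    have h := congrArg (fun g : Matrix.SpecialLinearGroup (Fin 2) ℝ =>
      (g : Matrix (Fin 2) (Fin 2) ℝ)) (inv_mul_cancel (pSL x hy * rot θ))
    rw [Matrix.SpecialLinearGroup.coe_mul, Matrix.SpecialLinearGroup.coe_mul,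
      Matrix.SpecialLinearGroup.coe_one] at h
    exact h
  rw [← key, integral_hypMeasure]
  congr 1
  ext w
  rw [← moebius_coe, hinv]

end
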